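/- arXiv:1204.5029 — 2 statements merged into one kernel-verified Lean document; each statement's English description precedes it below -/
import Mathlib

section
/- Let 1 ≤ p < ∞, let σ ∈ L^p(ℝ^{2d}) have compactly supported distributional Fourier transform, and let g ∈ L¹(ℝ^d) with ĝ ∈ L¹(ℝ^d). Then for every λ ∈ ℝ^{2d}, ∫_{ℝ^{2d}} σ(z) conj( R(π(λ)g, π(λ)g)(z) ) dz = (σ ∗ R(g,g)^∗)(λ), where R(g,g)^∗(x) = conj(R(g,g)(−x)); moreover the convolution σ ∗ R(g,g)^∗ coincides everywhere with a continuous function of λ, so this identity holds for every (not just almost every) λ ∈ ℝ^{2d}. In particular the diagonal entries of the channel matrix satisfy H_{λλ} = (σ ∗ R(g,g)^∗)(λ) for all λ ∈ Λ. -/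
noncomputable section

open MeasureTheory Complex Filter Real
open scoped FourierTransform Convolution Topology ENNReal

/-- first `d` coordinates of a point of ℝ^{d+d} -/
def zx {d : ℕ} (z : EuclideanSpace ℝ (Fin (d + d))) : EuclideanSpace ℝ (Fin d) :=
  (EuclideanSpace.equiv (Fin d) ℝ).symm fun i => z (Fin.castAdd d i)

/-- last `d` coordinates of a point of ℝ^{d+d} -/
def zxi {d : ℕ} (z : EuclideanSpace ℝ (Fin (d + d))) : EuclideanSpace ℝ (Fin d) :=
  (EuclideanSpace.equiv (Fin d) ℝ).symm fun i => z (Fin.natAdd d i)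

/-- build a point of ℝ^{d+d} from two points of ℝ^d -/
def mk2 {d : ℕ} (x ξ : EuclideanSpace ℝ (Fin d)) : EuclideanSpace ℝ (Fin (d + d)) :=
  (EuclideanSpace.equiv (Fin (d + d)) ℝ).symm fun i =>
    Sum.elim (fun j => x j) (fun j => ξ j) (finSumFinEquiv.symm i)

/-- the vector (a k₁, …, a k_d) ∈ ℝ^d for k ∈ ℤ^d -/
def vecd {d : ℕ} (a : ℝ) (k : Fin d → ℤ) : EuclideanSpace ℝ (Fin d) :=
  (EuclideanSpace.equiv (Fin d) ℝ).symm fun i => a * (k i : ℝ)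

/-- time-frequency shift π(x,ξ) f (t) = e^{2πi ξ·t} f(t-x) -/
def tf {d : ℕ} (x ξ : EuclideanSpace ℝ (Fin d)) (f : EuclideanSpace ℝ (Fin d) → ℂ) :
    EuclideanSpace ℝ (Fin d) → ℂ :=
  fun t => Complex.exp (2 * Real.pi * Complex.I * (inner ℝ ξ t : ℝ)) * f (t - x)

/-- short-time Fourier transform V_g f(x, ξ) = ∫ f(t) conj(g(t-x)) e^{-2πi ξ·t} dt -/
def stft {d : ℕ} (g f : EuclideanSpace ℝ (Fin d) → ℂ) (x ξ : EuclideanSpace ℝ (Fin d)) : ℂ :=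
  ∫ t, f t * (starRingEnd ℂ) (g (t - x)) *
    Complex.exp (-(2 * Real.pi * Complex.I) * (inner ℝ ξ t : ℝ))

/-- Rihaczek distribution R(f,g)(x,ξ) = f(x) conj(ĝ(ξ)) e^{-2πi x·ξ},
as a function on ℝ^{d+d} with variable z = (x, ξ) -/
def rihaczek {d : ℕ} (f g : EuclideanSpace ℝ (Fin d) → ℂ)
    (z : EuclideanSpace ℝ (Fin (d + d))) : ℂ :=
  f (zx z) * (starRingEnd ℂ) (𝓕 g (zxi z)) *
    Complex.exp (-(2 * Real.pi * Complex.I) * (inner ℝ (zx z) (zxi z) : ℝ))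

/-- (𝒰 V_g g)(ξ, x) = V_g g(-x, ξ), as a function on ℝ^{d+d} with variable z = (ξ, x) -/
def UVgg {d : ℕ} (g : EuclideanSpace ℝ (Fin d) → ℂ)
    (z : EuclideanSpace ℝ (Fin (d + d))) : ℂ :=
  stft g g (-(zxi z)) (zx z)

/-- the point (a k, b l) of the lattice Λ = aℤ^d × bℤ^d, as a point of ℝ^{d+d} -/
def lat {d : ℕ} (a b : ℝ) (kl : (Fin d → ℤ) × (Fin d → ℤ)) :
    EuclideanSpace ℝ (Fin (d + d)) :=
  mk2 (vecd a kl.1) (vecd b kl.2)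

/-- one-dimensional normalized sinc: t ↦ sin(πct)/(πct), equal to 1 at t = 0 -/
def sinc1 (c t : ℝ) : ℝ :=
  if t = 0 then 1 else Real.sin (Real.pi * c * t) / (Real.pi * c * t)

/-- the sinc function on ℝ^{d+d} adapted to the lattice aℤ^d × bℤ^d -/
def sincL {d : ℕ} (a b : ℝ) (z : EuclideanSpace ℝ (Fin (d + d))) : ℂ :=
  ((∏ i, sinc1 a (zx z i)) * ∏ i, sinc1 b (zxi z i) : ℝ)

/-- the closed box [-1/(2a)+ε, 1/(2a)-ε]^d × [-1/(2b)+ε, 1/(2b)-ε]^d ⊆ ℝ^{d+d};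
for ε = 0 this is the box Q = [-1/(2a), 1/(2a)]^d × [-1/(2b), 1/(2b)]^d -/
def Qbox {d : ℕ} (a b ε : ℝ) : Set (EuclideanSpace ℝ (Fin (d + d))) :=
  {z | (∀ i, |zx z i| ≤ 1 / (2 * a) - ε) ∧ (∀ i, |zxi z i| ≤ 1 / (2 * b) - ε)}

/-- diagonal entry H_{λλ} = ⟨σ^{KN} π(λ)g, π(λ)g⟩ = ∫ σ(z) conj(R(π(λ)g,π(λ)g)(z)) dz
of the channel matrix of a (locally integrable) symbol σ, at λ = (a k, b l) -/
def Hdiag {d : ℕ} (σ : EuclideanSpace ℝ (Fin (d + d)) → ℂ)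
    (g : EuclideanSpace ℝ (Fin d) → ℂ) (a b : ℝ) (kl : (Fin d → ℤ) × (Fin d → ℤ)) : ℂ :=
  ∫ z, σ z * (starRingEnd ℂ)
    (rihaczek (tf (vecd a kl.1) (vecd b kl.2) g) (tf (vecd a kl.1) (vecd b kl.2) g) z)

theorem MeasureTheory.Integrable.memLp_of_ae_norm_le {α E : Type*} [MeasurableSpace α]
    {μ : Measure α} [NormedAddCommGroup E] {f : α → E} (hf : Integrable f μ) {C : ℝ}
    (hC : ∀ᵐ x ∂μ, ‖f x‖ ≤ C) {q : ℝ≥0∞} (hq : 1 ≤ q) : MemLp f q μ := by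
  by_cases hq_top : q = ⊤
  · rw [hq_top]
    exact memLp_top_of_bound hf.1 C hC
  have hq_real : 1 ≤ q.toReal := by
    simpa using ENNReal.toReal_mono hq_top hq
  refine (integrable_norm_rpow_iff hf.1 (one_pos.trans_le hq).ne' hq_top).1 ?_
  refine (hf.norm.const_mul (C ^ (q.toReal - 1))).mono'
    (hf.1.norm.aemeasurable.pow_const _).aestronglyMeasurable ?_
  filter_upwards [hC] with x hx
  rw [Real.norm_of_nonneg (by positivity)]
  rcases eq_or_ne ‖f x‖ 0 with h0 | h0
  · simp [h0, Real.zero_rpow (one_pos.trans_le hq_real).ne']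
  calc ‖f x‖ ^ q.toReal = ‖f x‖ ^ (q.toReal - 1) * ‖f x‖ := by
        rw [Real.rpow_sub_one h0, div_mul_cancel₀ _ h0]
    _ ≤ C ^ (q.toReal - 1) * ‖f x‖ := by
        gcongr

section FourierInversion

variable {V : Type*} [NormedAddCommGroup V] [InnerProductSpace ℝ V] [FiniteDimensional ℝ V]
  [MeasurableSpace V] [BorelSpace V]

theorem norm_fourier_le_integral_norm (f : V → ℂ) (v : V) : ‖𝓕 f v‖ ≤ ∫ w, ‖f w‖ :=
  VectorFourier.norm_fourierIntegral_le_integral_norm _ _ _ _ _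

theorem continuous_fourier_of_integrable {f : V → ℂ} (hf : Integrable f) : Continuous (𝓕 f) :=
  VectorFourier.fourierIntegral_continuous Real.continuous_fourierChar
    (by exact continuous_inner) hf

theorem integral_fourier_mul_eq {f h : V → ℂ} (hf : Integrable f) (hh : Integrable h) :
    ∫ v, 𝓕 f v * h v = ∫ v, f v * 𝓕 h v := by
  have key := VectorFourier.integral_fourierIntegral_smul_eq_flip (L := innerₗ V)
    (μ := volume) (ν := volume) Real.continuous_fourierChar (by exact continuous_inner) hf hh
  rw [flip_innerₗ] at key
  exact key

/-- Fourier inversion almost everywhere, for integrable functions with integrable transform. -/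
theorem ae_eq_fourierInv_fourier {f : V → ℂ} (hf : Integrable f) (hf' : Integrable (𝓕 f)) :
    f =ᵐ[volume] 𝓕⁻ (𝓕 f) := by
  have hcont : Continuous (𝓕⁻ (𝓕 f)) := by
    rw [funext (Real.fourierInv_eq_fourier_neg (𝓕 f))]
    exact (continuous_fourier_of_integrable hf').comp continuous_neg
  refine ae_eq_of_integral_contDiff_smul_eq hf.locallyIntegrable hcont.locallyIntegrable
    fun φ hφ hφc => ?_
  let ψ : SchwartzMap V ℂ :=
    (hφc.comp_left (g := ((↑) : ℝ → ℂ)) ofReal_zero).toSchwartzMap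
      (ofRealCLM.contDiff.comp hφ)
  have hψ : ∀ v, ψ v = (φ v : ℂ) := fun v => rfl
  let η : SchwartzMap V ℂ := 𝓕⁻ ψ
  have hη : 𝓕 (⇑η) = ⇑ψ := by
    rw [← SchwartzMap.fourier_coe]
    exact congrArg _ (FourierTransform.fourier_fourierInv_eq ψ)
  have hη_inv : ∀ v, η v = 𝓕 (⇑ψ) (-v) := fun v => by
    rw [← Real.fourierInv_eq_fourier_neg, ← SchwartzMap.fourierInv_coe]
  calc ∫ v, φ v • f v = ∫ v, f v * 𝓕 (⇑η) v := by
        simp only [hη, hψ, real_smul, mul_comm]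
    _ = ∫ v, 𝓕 f v * 𝓕 (⇑ψ) (-v) := by
        rw [← integral_fourier_mul_eq hf η.integrable]
        simp only [hη_inv]
    _ = ∫ v, 𝓕 f (-v) * 𝓕 (⇑ψ) v := by
        rw [← integral_neg_eq_self]
        simp only [neg_neg]
    _ = ∫ v, 𝓕 (fun w => 𝓕 f (-w)) v * ψ v :=
        (integral_fourier_mul_eq hf'.comp_neg ψ.integrable).symm
    _ = ∫ v, φ v • 𝓕⁻ (𝓕 f) v := by
        simp only [Real.fourierInv_eq_fourier_comp_neg, hψ, real_smul, mul_comm]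

theorem ae_norm_le_integral_norm_fourier {f : V → ℂ} (hf : Integrable f)
    (hf' : Integrable (𝓕 f)) : ∀ᵐ v, ‖f v‖ ≤ ∫ w, ‖𝓕 f w‖ := by
  filter_upwards [ae_eq_fourierInv_fourier hf hf'] with v hv
  rw [hv, Real.fourierInv_eq_fourier_neg]
  exact norm_fourier_le_integral_norm _ _

end FourierInversion

/-- The convolution of functions in conjugate `L^p` spaces, `p < ∞`, is continuous. -/
theorem MeasureTheory.MemLp.continuous_convolution_of_holderConjugate
    {G : Type*} [NormedAddCommGroup G] [MeasurableSpace G] [BorelSpace G]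
    [LocallyCompactSpace G] [SecondCountableTopology G]
    {μ : Measure G} [μ.IsAddHaarMeasure]
    {p q : ℝ≥0∞} [p.HolderConjugate q] (hp1 : 1 ≤ p) (hp : p ≠ ⊤) {f h : G → ℂ}
    (hf : MemLp f p μ) (hh : MemLp h q μ) :
    Continuous (convolution f h (ContinuousLinearMap.mul ℂ ℂ) μ) := by
  have : Fact (1 ≤ p) := ⟨hp1⟩
  have : Fact (1 ≤ q) := ⟨ENNReal.HolderConjugate.one_le q p⟩
  have : Fact (p ≠ ⊤) := ⟨hp⟩
  have hh' : MemLp (fun t => h (-t)) q μ :=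
    hh.comp_measurePreserving (Measure.measurePreserving_neg μ)
  have key : convolution f h (ContinuousLinearMap.mul ℂ ℂ) μ = fun x =>
      (ContinuousLinearMap.mul ℂ ℂ).lpPairing μ p q (DomAddAct.mk x +ᵥ hf.toLp f)
        (hh'.toLp _) := by
    funext x
    rw [ContinuousLinearMap.lpPairing_eq_integral, convolution_def,
      ← integral_add_left_eq_self _ x, DomAddAct.mk_vadd_toLp]
    refine integral_congr_ae ?_
    have hfx : MemLp (fun t => f (x +ᵥ t)) p μ :=
      hf.comp_measurePreserving (measurePreserving_vadd x μ)
    filter_upwards [hh'.coeFn_toLp, hfx.coeFn_toLp] with t h1 h2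
    rw [h1, h2]
    simp [vadd_eq_add]
  rw [key]
  have hcont : Continuous fun x : G => (DomAddAct.mk x +ᵥ hf.toLp f : Lp ℂ p μ) :=
    (DomAddAct.continuous_mk).vadd continuous_const
  exact (((ContinuousLinearMap.mul ℂ ℂ).lpPairing μ p q).continuous.comp hcont).clm_apply
    continuous_const

theorem measurePreserving_zx_zxi {d : ℕ} :
    MeasurePreserving (fun z : EuclideanSpace ℝ (Fin (d + d)) => (zx z, zxi z)) := by
  have h1 := (LinearIsometryEquiv.piLpCongrLeft 2 ℝ ℝ
    (finSumFinEquiv (m := d) (n := d)).symm).measurePreserving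
  have h2 := (PiLp.sumPiLpEquivProdLpPiLp (𝕜 := ℝ) 2
    (fun _ : Fin d ⊕ Fin d => ℝ)).measurePreserving
  have h3 := WithLp.volume_preserving_ofLp (EuclideanSpace ℝ (Fin d)) (EuclideanSpace ℝ (Fin d))
  exact h3.comp (h2.comp h1)

theorem continuous_zx {d : ℕ} : Continuous (zx (d := d)) := by
  unfold zx
  fun_prop

theorem continuous_zxi {d : ℕ} : Continuous (zxi (d := d)) := by
  unfold zxi
  fun_prop

theorem norm_exp_neg_two_pi_I_mul (t : ℝ) :
    ‖Complex.exp (-(2 * Real.pi * Complex.I) * (t : ℝ))‖ = 1 := by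
  rw [show -(2 * Real.pi * Complex.I) * (t : ℂ) = ((-(2 * Real.pi * t) : ℝ) : ℂ) * Complex.I by
    push_cast; ring]
  exact Complex.norm_exp_ofReal_mul_I _

theorem norm_rihaczek {d : ℕ} (f g : EuclideanSpace ℝ (Fin d) → ℂ)
    (z : EuclideanSpace ℝ (Fin (d + d))) :
    ‖rihaczek f g z‖ = ‖f (zx z)‖ * ‖𝓕 g (zxi z)‖ := by
  simp only [rihaczek, norm_mul, norm_exp_neg_two_pi_I_mul, mul_one, RCLike.norm_conj]

theorem integrable_rihaczek {d : ℕ} {f g : EuclideanSpace ℝ (Fin d) → ℂ}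
    (hf : Integrable f) (hg : Integrable (𝓕 g)) : Integrable (rihaczek f g) := by
  have hconj : Integrable fun ξ => (starRingEnd ℂ) (𝓕 g ξ) :=
    hg.congr' (continuous_conj.comp_aestronglyMeasurable hg.1)
      (.of_forall fun ξ => (RCLike.norm_conj _).symm)
  have hprod : Integrable fun z : EuclideanSpace ℝ (Fin (d + d)) =>
      f (zx z) * (starRingEnd ℂ) (𝓕 g (zxi z)) :=
    measurePreserving_zx_zxi.integrable_comp_of_integrable (hf.mul_prod hconj)
  refine hprod.mul_bdd (c := 1) ?_ (.of_forall fun z => (norm_exp_neg_two_pi_I_mul _).le)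
  have hinner : Continuous fun z : EuclideanSpace ℝ (Fin (d + d)) => inner ℝ (zx z) (zxi z) :=
    continuous_zx.inner continuous_zxi
  exact (by fun_prop : Continuous fun z : EuclideanSpace ℝ (Fin (d + d)) =>
    Complex.exp (-(2 * Real.pi * Complex.I) *
      (inner ℝ (zx z) (zxi z) : ℝ))).aestronglyMeasurable

theorem memLp_rihaczek_self {d : ℕ} {g : EuclideanSpace ℝ (Fin d) → ℂ}
    (hg : Integrable g) (hghat : Integrable (𝓕 g)) {q : ℝ≥0∞} (hq : 1 ≤ q) :
    MemLp (rihaczek g g) q := by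
  refine (integrable_rihaczek hg hghat).memLp_of_ae_norm_le
    (C := (∫ w, ‖𝓕 g w‖) * ∫ w, ‖g w‖) ?_ hq
  have hzx : Measure.QuasiMeasurePreserving (zx (d := d)) :=
    Measure.quasiMeasurePreserving_fst.comp measurePreserving_zx_zxi.quasiMeasurePreserving
  filter_upwards [hzx.ae (ae_norm_le_integral_norm_fourier hg hghat)] with z hz
  rw [norm_rihaczek]
  exact mul_le_mul hz (norm_fourier_le_integral_norm _ _) (norm_nonneg _)
    (integral_nonneg fun _ => norm_nonneg _)

theorem fourier_tf {d : ℕ} (x ξ : EuclideanSpace ℝ (Fin d)) (f : EuclideanSpace ℝ (Fin d) → ℂ)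
    (η : EuclideanSpace ℝ (Fin d)) :
    𝓕 (tf x ξ f) η =
      Complex.exp (-(2 * Real.pi * Complex.I) * (inner ℝ x (η - ξ) : ℝ)) * 𝓕 f (η - ξ) := by
  rw [Real.fourier_eq', Real.fourier_eq', ← integral_const_mul, ← integral_add_right_eq_self _ x]
  refine integral_congr_ae (.of_forall fun t => ?_)
  simp only [tf, smul_eq_mul, add_sub_cancel_right]
  rw [← mul_assoc, ← mul_assoc, ← Complex.exp_add, ← Complex.exp_add]
  congr 2
  simp only [inner_add_left, inner_add_right, inner_sub_right, real_inner_comm t ξ,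
    real_inner_comm x ξ]
  push_cast
  ring

theorem zx_sub {d : ℕ} (z w : EuclideanSpace ℝ (Fin (d + d))) : zx (z - w) = zx z - zx w := rfl

theorem zxi_sub {d : ℕ} (z w : EuclideanSpace ℝ (Fin (d + d))) :
    zxi (z - w) = zxi z - zxi w := rfl

theorem zx_mk2 {d : ℕ} (x ξ : EuclideanSpace ℝ (Fin d)) : zx (mk2 x ξ) = x := by
  ext i
  simp [zx, mk2]

theorem zxi_mk2 {d : ℕ} (x ξ : EuclideanSpace ℝ (Fin d)) : zxi (mk2 x ξ) = ξ := by
  ext i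
  exact congrArg (Sum.elim (fun j => x j) (fun j => ξ j)) (finSumFinEquiv_symm_apply_natAdd i)

/-- Covariance of the Rihaczek distribution under time-frequency shifts. -/
theorem rihaczek_tf {d : ℕ} (x ξ : EuclideanSpace ℝ (Fin d))
    (f g : EuclideanSpace ℝ (Fin d) → ℂ) (z : EuclideanSpace ℝ (Fin (d + d))) :
    rihaczek (tf x ξ f) (tf x ξ g) z = rihaczek f g (z - mk2 x ξ) := by
  simp only [rihaczek, fourier_tf, zx_sub, zxi_sub, zx_mk2, zxi_mk2, tf, map_mul,
    ← Complex.exp_conj]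
  have hexp : ∀ a b c e u v : ℂ, a + b + c = e →
      Complex.exp a * u * (Complex.exp b * v) * Complex.exp c = u * v * Complex.exp e := by
    rintro a b c e u v rfl
    rw [Complex.exp_add, Complex.exp_add]
    ring
  refine hexp _ _ _ _ _ _ ?_
  simp only [map_neg, map_mul, map_ofNat, conj_ofReal, conj_I, inner_sub_left, inner_sub_right,
    real_inner_comm (zx z) ξ]
  push_cast
  ring

/-- for σ ∈ L^p(ℝ^{2d}), 1 ≤ p < ∞, with compactly supported distributional
Fourier transform and g ∈ L¹ with ĝ ∈ L¹, the map λ ↦ σ ∗ R(g,g)^∗(λ) is continuous and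
for every λ = (x,ξ) ∈ ℝ^{2d} one has ∫ σ(z) conj(R(π(λ)g,π(λ)g)(z)) dz = (σ ∗ R(g,g)^∗)(λ);
in particular H_{λλ} = (σ ∗ R(g,g)^∗)(λ) for all lattice points λ. -/
theorem statement_1 {d : ℕ} (p : ℝ≥0∞) (hp1 : 1 ≤ p) (hp2 : p ≠ ⊤)
    (σ : EuclideanSpace ℝ (Fin (d + d)) → ℂ) (hσ : MeasureTheory.MemLp σ p volume)
    (hσhat : ∃ S : Set (EuclideanSpace ℝ (Fin (d + d))), IsCompact S ∧
      ∀ ψ : SchwartzMap (EuclideanSpace ℝ (Fin (d + d))) ℂ,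
        Disjoint (tsupport ⇑ψ) S → ∫ z, σ z * 𝓕 (⇑ψ) z = 0)
    (g : EuclideanSpace ℝ (Fin d) → ℂ)
    (hg : MeasureTheory.Integrable g) (hghat : MeasureTheory.Integrable (𝓕 g)) :
    Continuous (convolution σ (fun w => (starRingEnd ℂ) (rihaczek g g (-w)))
      (ContinuousLinearMap.mul ℂ ℂ) volume) ∧
    ∀ x ξ : EuclideanSpace ℝ (Fin d),
      (∫ z, σ z * (starRingEnd ℂ) (rihaczek (tf x ξ g) (tf x ξ g) z)) =
        convolution σ (fun w => (starRingEnd ℂ) (rihaczek g g (-w)))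
          (ContinuousLinearMap.mul ℂ ℂ) volume (mk2 x ξ) := by
  refine ⟨?_, fun x ξ => ?_⟩
  · have hconj : p.HolderConjugate p.conjExponent := .conjExponent hp1
    have hq : 1 ≤ p.conjExponent := le_self_add
    exact hσ.continuous_convolution_of_holderConjugate (q := p.conjExponent) hp1 hp2
      ((memLp_rihaczek_self hg hghat hq).comp_measurePreserving
        (Measure.measurePreserving_neg volume)).star
  · rw [convolution_def]
    simp only [rihaczek_tf, neg_sub, ContinuousLinearMap.mul_apply']
end
end

section
/- Let σ: ℝ² → ℂ have Fourier transform σ̂ ∈ L¹(ℝ²) with compact support, let φ(x) = e^{−πx²} be the Gaussian, and let Λ = aℤ × bℤ with a, b > 0. If ⟨σ^{KN} π(μ)φ, π(λ)φ⟩ = ∫_{ℝ²} σ̂(z) conj( ℱ(R(π(λ)φ, π(μ)φ))(z) ) dz = 0 for all λ, μ ∈ Λ, then σ̂ = 0 almost everywhere (so σ^{KN} is the zero operator). -/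
noncomputable section

open MeasureTheory Complex Filter Real
open scoped FourierTransform Convolution Topology ENNReal

/-- the Gaussian φ(x) = e^{−πx²} on ℝ (as a function on the 1-dimensional Euclidean space) -/
def gauss : EuclideanSpace ℝ (Fin 1) → ℂ :=
  fun t => ((Real.exp (-Real.pi * (t 0) ^ 2) : ℝ) : ℂ)

theorem HasCompactSupport.integrable_continuousMap_smul {E : Type*} [TopologicalSpace E]
    [MeasurableSpace E] [OpensMeasurableSpace E] {μ : Measure E} {G : E → ℂ}
    (hGc : HasCompactSupport G) (hG : Integrable G μ) (f : C(E, ℝ)) :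
    Integrable (fun z => f z • G z) μ := by
  obtain ⟨C, hC⟩ := hGc.isCompact.exists_bound_of_continuousOn f.continuous.continuousOn
  refine (hG.norm.const_mul C).mono' (f.continuous.aestronglyMeasurable.smul hG.1) ?_
  refine .of_forall fun z => ?_
  rw [norm_smul]
  by_cases hz : z ∈ tsupport G
  · exact mul_le_mul_of_nonneg_right (hC z hz) (norm_nonneg _)
  · simp [image_eq_zero_of_notMem_tsupport hz]

/-- A compactly supported integrable function that is orthogonal to a point-separating algebra of
continuous functions vanishes almost everywhere. -/
theorem ae_eq_zero_of_integral_subalgebra_smul_eq_zero {E : Type*} [NormedAddCommGroup E]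
    [NormedSpace ℝ E] [FiniteDimensional ℝ E] [MeasurableSpace E] [BorelSpace E] {μ : Measure E}
    {G : E → ℂ} (hG : Integrable G μ) (hGc : HasCompactSupport G) {A : Subalgebra ℝ C(E, ℝ)}
    (hA : A.SeparatesPoints) (h : ∀ f ∈ A, ∫ z, f z • G z ∂μ = 0) : G =ᵐ[μ] 0 := by
  refine ae_eq_zero_of_integral_contDiff_smul_eq_zero hG.locallyIntegrable fun g hg _ => ?_
  let gc : C(E, ℝ) := ⟨g, hg.continuous⟩
  have norm_le : ∀ ε > 0, ‖∫ z, g z • G z ∂μ‖ ≤ ε * ∫ z, ‖G z‖ ∂μ := by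
    intro ε hε
    obtain ⟨f, hfA, hf⟩ :=
      ContinuousMap.exists_mem_subalgebra_near_continuous_of_isCompact_of_separatesPoints
        hA gc hGc.isCompact hε
    have heq : ∫ z, g z • G z ∂μ = ∫ z, (gc z - f z) • G z ∂μ := by
      simp_rw [sub_smul]
      rw [integral_sub (hGc.integrable_continuousMap_smul hG gc)
        (hGc.integrable_continuousMap_smul hG f), h f hfA, sub_zero]
      rfl
    rw [heq, ← integral_const_mul]
    refine norm_integral_le_of_norm_le (hG.norm.const_mul ε) (.of_forall fun z => ?_)
    rw [norm_smul]
    by_cases hz : z ∈ tsupport G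
    · rw [norm_sub_rev]
      exact mul_le_mul_of_nonneg_right (hf z hz).le (norm_nonneg _)
    · simp [image_eq_zero_of_notMem_tsupport hz]
  have hlim : Tendsto (fun ε : ℝ => ε * ∫ z, ‖G z‖ ∂μ) (𝓝[>] 0) (𝓝 0) := by
    have := (tendsto_id (α := ℝ) (x := 𝓝 0)).mul_const (∫ z, ‖G z‖ ∂μ)
    rw [zero_mul] at this
    exact this.mono_left nhdsWithin_le_nhds
  exact norm_le_zero_iff.1 (ge_of_tendsto hlim (eventually_mem_nhdsWithin.mono norm_le))

/-- A compactly supported integrable function all of whose moments with respect to two functions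
that jointly separate points are zero vanishes almost everywhere. -/
theorem ae_eq_zero_of_integral_pow_mul_pow_smul_eq_zero {E : Type*} [NormedAddCommGroup E]
    [NormedSpace ℝ E] [FiniteDimensional ℝ E] [MeasurableSpace E] [BorelSpace E] {μ : Measure E}
    {G : E → ℂ} (hG : Integrable G μ) (hGc : HasCompactSupport G) (X Y : C(E, ℝ))
    (hXY : ∀ z w, X z = X w → Y z = Y w → z = w)
    (h : ∀ i j : ℕ, ∫ z, (X z ^ i * Y z ^ j) • G z ∂μ = 0) : G =ᵐ[μ] 0 := by
  refine ae_eq_zero_of_integral_subalgebra_smul_eq_zero hG hGc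
    (A := Algebra.adjoin ℝ {X, Y}) ?_ fun f hf => ?_
  · intro z w hzw
    by_cases hX : X z = X w
    · exact ⟨Y, ⟨Y, Algebra.subset_adjoin (by simp), rfl⟩, fun hY => hzw (hXY z w hX hY)⟩
    · exact ⟨X, ⟨X, Algebra.subset_adjoin (by simp), rfl⟩, hX⟩
  · rw [← Subalgebra.mem_toSubmodule, Algebra.adjoin_eq_span] at hf
    induction hf using Submodule.span_induction with
    | mem f hf =>
      obtain ⟨i, j, rfl⟩ := (Submonoid.mem_closure_pair _ _ _).1 hf
      simpa using h i j
    | zero => simp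
    | add f g _ _ hf hg =>
      simp_rw [ContinuousMap.add_apply, add_smul]
      rw [integral_add (hGc.integrable_continuousMap_smul hG f)
        (hGc.integrable_continuousMap_smul hG g), hf, hg, add_zero]
    | smul c f _ hf =>
      simp_rw [ContinuousMap.smul_apply, smul_assoc]
      rw [integral_smul, hf, smul_zero]

theorem integral_euclideanSpace_fin_one (f : EuclideanSpace ℝ (Fin 1) → ℂ) :
    ∫ z, f z = ∫ t : ℝ, f (WithLp.toLp 2 fun _ => t) := by
  rw [← (PiLp.volume_preserving_toLp (Fin 1)).integral_comp
      (MeasurableEquiv.toLp 2 _).measurableEmbedding]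
  exact ((volume_preserving_funUnique (Fin 1) ℝ).symm.integral_comp
    (MeasurableEquiv.funUnique (Fin 1) ℝ).symm.measurableEmbedding
    fun x => f (WithLp.toLp 2 x)).symm

theorem integral_euclideanSpace_fin_two (f : EuclideanSpace ℝ (Fin 2) → ℂ) :
    ∫ z, f z = ∫ p : ℝ × ℝ, f !₂[p.1, p.2] := by
  rw [← (PiLp.volume_preserving_toLp (Fin 2)).integral_comp
      (MeasurableEquiv.toLp 2 _).measurableEmbedding,
    ← (volume_preserving_finTwoArrow ℝ).symm.integral_comp
      (MeasurableEquiv.finTwoArrow).symm.measurableEmbedding]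
  rfl

theorem tf_gauss_apply (x ξ : ℝ) (t : EuclideanSpace ℝ (Fin 1)) :
    tf (WithLp.toLp 2 fun _ => x) (WithLp.toLp 2 fun _ => ξ) gauss t =
      cexp (2 * π * I * ξ * t 0 - π * (t 0 - x) ^ 2) := by
  simp only [tf, gauss, ofReal_exp, ← Complex.exp_add]
  congr 1
  simp [PiLp.inner_apply]
  ring

theorem fourier_tf_gauss (y η : ℝ) (w : EuclideanSpace ℝ (Fin 1)) :
    𝓕 (tf (WithLp.toLp 2 fun _ => y) (WithLp.toLp 2 fun _ => η) gauss) w =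
      cexp (-(2 * π * I) * (w 0 - η) * y - π * (w 0 - η) ^ 2) := by
  have hπ : (π : ℂ) ≠ 0 := by exact_mod_cast Real.pi_ne_zero
  rw [Real.fourier_eq', integral_euclideanSpace_fin_one]
  simp only [tf_gauss_apply, smul_eq_mul, ← Complex.exp_add]
  have key := integral_cexp_quadratic (b := -π) (by simp [Real.pi_pos])
    (2 * π * (y + I * (η - w 0))) (-π * y ^ 2)
  rw [neg_neg, div_self hπ, one_cpow, one_mul] at key
  convert key using 1
  · congr 1 with t
    congr 1
    simp [PiLp.inner_apply]
    ring
  · congr 1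
    field_simp
    ring_nf
    simp only [I_sq]
    ring

theorem fourier_rihaczek_tf_gauss (x ξ y η : ℝ) (z : EuclideanSpace ℝ (Fin (1 + 1))) :
    𝓕 (rihaczek (tf (WithLp.toLp 2 fun _ => x) (WithLp.toLp 2 fun _ => ξ) gauss)
        (tf (WithLp.toLp 2 fun _ => y) (WithLp.toLp 2 fun _ => η) gauss)) z =
      (1 / 2 : ℂ) ^ (1 / 2 : ℂ) *
        cexp (-(2 * π * I) * η * z 1 - π * (x - y + z 1) ^ 2 / 2
          - π * I * (z 0 + η - ξ) * (x + y - z 1) - π * (z 0 + η - ξ) ^ 2 / 2) := by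
  have hπ : (π : ℂ) ≠ 0 := by exact_mod_cast Real.pi_ne_zero
  rw [Real.fourier_eq', integral_euclideanSpace_fin_two]
  have hR : ∀ p : ℝ × ℝ,
      cexp (↑(-2 * π * inner ℝ (!₂[p.1, p.2] : EuclideanSpace ℝ (Fin 2)) z) * I) •
      rihaczek (tf (WithLp.toLp 2 fun _ => x) (WithLp.toLp 2 fun _ => ξ) gauss)
        (tf (WithLp.toLp 2 fun _ => y) (WithLp.toLp 2 fun _ => η) gauss) !₂[p.1, p.2] =
      cexp (-π * p.1 ^ 2 + (2 * π * x + 2 * π * I * (ξ - z 0)) * p.1 + -π * x ^ 2) *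
        cexp (-π * p.2 ^ 2 + (2 * π * η + 2 * π * I * (y - z 1 - p.1)) * p.2
          + (-π * η ^ 2 - 2 * π * I * η * y)) := by
    intro p
    simp only [rihaczek, tf_gauss_apply, fourier_tf_gauss, smul_eq_mul, ← Complex.exp_conj,
      ← Complex.exp_add]
    congr 1
    simp [zx, zxi, PiLp.inner_apply, Fin.sum_univ_two, map_ofNat (starRingEnd ℂ)]
    ring
  have hint : Integrable (fun p : ℝ × ℝ =>
      cexp (-π * p.1 ^ 2 + (2 * π * x + 2 * π * I * (ξ - z 0)) * p.1 + -π * x ^ 2) *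
        cexp (-π * p.2 ^ 2 + (2 * π * η + 2 * π * I * (y - z 1 - p.1)) * p.2
          + (-π * η ^ 2 - 2 * π * I * η * y))) := by
    have hb : (-π : ℂ).re < 0 := by simp [Real.pi_pos]
    refine ((integrable_cexp_quadratic' hb (2 * π * x + 2 * π * I * (ξ - z 0))
      (-π * x ^ 2)).mul_prod (integrable_cexp_quadratic' hb
      (2 * π * η + 2 * π * I * (y - z 1)) (-π * η ^ 2 - 2 * π * I * η * y))).mono
      (Continuous.aestronglyMeasurable (by fun_prop)) (.of_forall fun p => le_of_eq ?_)
    simp only [norm_mul, Complex.norm_exp]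
    congr 2
    simp [← ofReal_pow]
  have inner_integral : ∀ t : ℝ, ∫ s : ℝ,
      cexp (-π * t ^ 2 + (2 * π * x + 2 * π * I * (ξ - z 0)) * t + -π * x ^ 2) *
        cexp (-π * s ^ 2 + (2 * π * η + 2 * π * I * (y - z 1 - t)) * s
          + (-π * η ^ 2 - 2 * π * I * η * y)) =
      cexp (-(2 * π) * t ^ 2 + (2 * π * (x + y - z 1) + 2 * π * I * (ξ - z 0 - η)) * t +
        (-π * x ^ 2 - π * (y - z 1) ^ 2 - 2 * π * I * η * z 1)) := by
    intro t
    rw [integral_const_mul, integral_cexp_quadratic (by simp [Real.pi_pos]), neg_neg,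
      div_self hπ, one_cpow, one_mul, ← Complex.exp_add]
    congr 1
    field_simp
    ring_nf
    simp only [I_sq]
    ring
  simp only [hR]
  rw [Measure.volume_eq_prod, integral_prod _ hint]
  simp only [inner_integral]
  rw [integral_cexp_quadratic (by simp [Real.pi_pos]), neg_neg]
  congr 2
  · field_simp
  · field_simp
    ring_nf
    simp only [I_sq]
    ring

/-- if σ̂ ∈ L¹(ℝ²) is compactly supported and all channel-matrix entries
⟨σ^{KN} π(μ)φ, π(λ)φ⟩ = ∫ σ̂(z) conj(ℱ(R(π(λ)φ, π(μ)φ))(z)) dz of the Gaussian Gabor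
system over aℤ × bℤ vanish, then σ̂ = 0 almost everywhere. -/
theorem statement_7 (a b : ℝ) (ha : 0 < a) (hb : 0 < b)
    (σhat : EuclideanSpace ℝ (Fin (1 + 1)) → ℂ)
    (hσ1 : MeasureTheory.Integrable σhat) (hσc : HasCompactSupport σhat)
    (h0 : ∀ kl mn : ℤ × ℤ,
      ∫ z, σhat z * (starRingEnd ℂ)
        (𝓕 (rihaczek (tf (vecd a fun _ => kl.1) (vecd b fun _ => kl.2) gauss)
                      (tf (vecd a fun _ => mn.1) (vecd b fun _ => mn.2) gauss)) z) = 0) :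
    σhat =ᵐ[volume] 0 := by
  let G : EuclideanSpace ℝ (Fin (1 + 1)) → ℂ := fun z =>
    cexp (-(π * (I * z 0 * z 1 + (z 0 ^ 2 + z 1 ^ 2) / 2))) * σhat z
  have hGc : HasCompactSupport G := hσc.mul_left
  have hG : Integrable G := by
    refine hσ1.norm.mono' (Continuous.aestronglyMeasurable (by fun_prop) |>.mul hσ1.1)
      (.of_forall fun z => ?_)
    rw [norm_mul, Complex.norm_exp]
    refine mul_le_of_le_one_left (norm_nonneg _) (Real.exp_le_one_iff.2 ?_)
    simp [← ofReal_pow]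
    positivity
  let X : C(EuclideanSpace ℝ (Fin (1 + 1)), ℝ) :=
    ⟨fun z => Real.exp (2 * π * a * z 1), by fun_prop⟩
  let Y : C(EuclideanSpace ℝ (Fin (1 + 1)), ℝ) :=
    ⟨fun z => Real.exp (2 * π * b * z 0), by fun_prop⟩
  have hG0 : G =ᵐ[volume] 0 := by
    refine ae_eq_zero_of_integral_pow_mul_pow_smul_eq_zero hG hGc X Y ?_ fun i j => ?_
    · intro z w hX hY
      have h1 : z 1 = w 1 :=
        mul_left_cancel₀ (by positivity : 2 * π * a ≠ 0) (Real.exp_injective hX)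
      have h0 : z 0 = w 0 :=
        mul_left_cancel₀ (by positivity : 2 * π * b ≠ 0) (Real.exp_injective hY)
      ext k
      fin_cases k
      · exact h0
      · exact h1
    · let c : ℂ := (starRingEnd ℂ) ((1 / 2 : ℂ) ^ (1 / 2 : ℂ)) *
        cexp (-(2 * π * ((a * i) ^ 2 + (b * j) ^ 2)))
      have hc : c ≠ 0 := by
        refine mul_ne_zero ?_ (Complex.exp_ne_zero _)
        rw [map_ne_zero]
        simp
      have h := h0 (-i, j) (i, -j)
      have hv : ∀ (r : ℝ) (n : ℤ),
          (vecd r fun _ : Fin 1 => n) = WithLp.toLp 2 fun _ => r * n := fun _ _ => rfl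
      simp only [hv, fourier_rihaczek_tf_gauss] at h
      refine (mul_eq_zero_iff_left hc).1 ?_
      rw [← integral_const_mul, ← h]
      congr 1 with z
      simp only [G, X, Y, c, ContinuousMap.coe_mk, real_smul, map_mul, ← Complex.exp_conj,
        ofReal_mul, ofReal_pow, ofReal_exp, ← Complex.exp_nat_mul]
      rw [mul_comm (σhat z), ← mul_assoc _ _ (σhat z), ← mul_assoc _ _ (σhat z)]
      simp only [mul_assoc (starRingEnd ℂ _), ← Complex.exp_add]
      congr 3
      simp [map_ofNat (starRingEnd ℂ)]
      ring
  filter_upwards [hG0] with z hz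
  exact (mul_eq_zero.1 hz).resolve_left (Complex.exp_ne_zero _)
end
end
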